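/- arXiv:2111.09885 — 8 statements merged into one kernel-verified Lean document; each statement's English description precedes it below -/
import Mathlib

section
/- For all real numbers l, u with 0 < l ≤ u < 1, setting η = max((u−l)/l, (u−l)/(1−u)), one has (1−η)·(u−l)²/(2l(1−l)) ≤ d(l,u) ≤ (1+η)·(u−l)²/(2l(1−l)). In particular, when u−l is small relative to l and 1−u, d(l,u) is approximated by (u−l)²/(2l(1−l)) up to a multiplicative factor close to 1. -/
/-- Bernoulli Kullback–Leibler divergence. -/
noncomputable def klBern (p q : ℝ) : ℝ :=
  p * Real.log (p / q) + (1 - p) * Real.log ((1 - p) / (1 - q))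

theorem klBern_self {p : ℝ} (h0 : 0 < p) (h1 : p < 1) : klBern p p = 0 := by
  simp [klBern, div_self h0.ne', div_self (sub_pos.2 h1).ne']

theorem hasDerivAt_klBern {p x : ℝ} (hp0 : 0 < p) (hp1 : p < 1) (h0 : 0 < x) (h1 : x < 1) :
    HasDerivAt (klBern p) ((x - p) / (x * (1 - x))) x := by
  have hx : x ≠ 0 := h0.ne'
  have hx' : 1 - x ≠ 0 := (sub_pos.2 h1).ne'
  have hp : p ≠ 0 := hp0.ne'
  have hp' : 1 - p ≠ 0 := (sub_pos.2 hp1).ne'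
  have hsub : HasDerivAt (fun y : ℝ => 1 - y) (-1) x := (hasDerivAt_id x).const_sub 1
  have hlog := (((hasDerivAt_const x p).fun_div (hasDerivAt_id' x) hx).log
    (div_ne_zero hp hx)).const_mul p
  have hlog' := (((hasDerivAt_const x (1 - p)).fun_div hsub hx').log
    (div_ne_zero hp' hx')).const_mul (1 - p)
  refine (hlog.fun_add hlog').congr_deriv ?_
  field_simp
  ring

theorem hasDerivAt_klBern_sub_sq {p x : ℝ} (K : ℝ) (hp0 : 0 < p) (hp1 : p < 1) (h0 : 0 < x)
    (h1 : x < 1) :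
    HasDerivAt (fun y => klBern p y - K * (y - p) ^ 2 / 2)
      ((x - p) * (1 / (x * (1 - x)) - K)) x := by
  have hsq := ((((hasDerivAt_id' x).sub_const p).fun_pow 2).const_mul K).div_const 2
  refine ((hasDerivAt_klBern hp0 hp1 h0 h1).fun_sub hsq).congr_deriv ?_
  push_cast
  ring

theorem klBern_le_of_inv_le {l u K : ℝ} (hl : 0 < l) (hlu : l ≤ u) (hu : u < 1)
    (hK : ∀ x ∈ Set.Ioo l u, 1 / (x * (1 - x)) ≤ K) :
    klBern l u ≤ K * (u - l) ^ 2 / 2 := by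
  have hd : ∀ x ∈ Set.Icc l u, HasDerivAt (fun y => klBern l y - K * (y - l) ^ 2 / 2)
      ((x - l) * (1 / (x * (1 - x)) - K)) x := fun x hx =>
    hasDerivAt_klBern_sub_sq K hl (hlu.trans_lt hu) (hl.trans_le hx.1) (hx.2.trans_lt hu)
  have hmono : AntitoneOn (fun y => klBern l y - K * (y - l) ^ 2 / 2) (Set.Icc l u) := by
    refine antitoneOn_of_deriv_nonpos (convex_Icc l u)
      (fun x hx => (hd x hx).continuousAt.continuousWithinAt)
      (fun x hx => (hd x (interior_subset hx)).differentiableAt.differentiableWithinAt)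
      fun x hx => ?_
    rw [(hd x (interior_subset hx)).deriv]
    rw [interior_Icc] at hx
    exact mul_nonpos_of_nonneg_of_nonpos (sub_nonneg.2 hx.1.le) (sub_nonpos.2 (hK x hx))
  have h := hmono (Set.left_mem_Icc.2 hlu) (Set.right_mem_Icc.2 hlu) hlu
  simpa [klBern_self hl (hlu.trans_lt hu)] using h

theorem le_klBern_of_le_inv {l u K : ℝ} (hl : 0 < l) (hlu : l ≤ u) (hu : u < 1)
    (hK : ∀ x ∈ Set.Ioo l u, K ≤ 1 / (x * (1 - x))) :
    K * (u - l) ^ 2 / 2 ≤ klBern l u := by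
  have hd : ∀ x ∈ Set.Icc l u, HasDerivAt (fun y => klBern l y - K * (y - l) ^ 2 / 2)
      ((x - l) * (1 / (x * (1 - x)) - K)) x := fun x hx =>
    hasDerivAt_klBern_sub_sq K hl (hlu.trans_lt hu) (hl.trans_le hx.1) (hx.2.trans_lt hu)
  have hmono : MonotoneOn (fun y => klBern l y - K * (y - l) ^ 2 / 2) (Set.Icc l u) := by
    refine monotoneOn_of_deriv_nonneg (convex_Icc l u)
      (fun x hx => (hd x hx).continuousAt.continuousWithinAt)
      (fun x hx => (hd x (interior_subset hx)).differentiableAt.differentiableWithinAt)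
      fun x hx => ?_
    rw [(hd x (interior_subset hx)).deriv]
    rw [interior_Icc] at hx
    exact mul_nonneg (sub_nonneg.2 hx.1.le) (sub_nonneg.2 (hK x hx))
  have h := hmono (Set.left_mem_Icc.2 hlu) (Set.right_mem_Icc.2 hlu) hlu
  simpa [klBern_self hl (hlu.trans_lt hu)] using h

/-- For `0 < l ≤ u < 1`, setting `η = max((u−l)/l, (u−l)/(1−u))`, one has
`(1−η)·(u−l)²/(2l(1−l)) ≤ d(l,u) ≤ (1+η)·(u−l)²/(2l(1−l))`. -/
theorem klBern_quadratic_approx (l u : ℝ) (hl : 0 < l) (hlu : l ≤ u) (hu : u < 1) :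
    (1 - max ((u - l) / l) ((u - l) / (1 - u))) * (u - l) ^ 2 / (2 * l * (1 - l))
      ≤ klBern l u ∧
    klBern l u ≤
      (1 + max ((u - l) / l) ((u - l) / (1 - u))) * (u - l) ^ 2 / (2 * l * (1 - l)) := by
  have hl' : 0 < 1 - l := by linarith
  have hu' : 0 < 1 - u := by linarith
  have hu0 : 0 < u := hl.trans_le hlu
  have hscale (c : ℝ) : c * (u - l) ^ 2 / (2 * l * (1 - l))
      = c / (l * (1 - l)) * (u - l) ^ 2 / 2 := by
    field_simp
  rw [hscale, hscale]
  constructor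
  · refine le_klBern_of_le_inv hl hlu hu fun x hx => ?_
    have hx0 : 0 < x := hl.trans hx.1
    have hx1 : 0 < 1 - x := by linarith [hx.2]
    have hη : 1 - max ((u - l) / l) ((u - l) / (1 - u)) ≤ l / u := by
      have h : 1 - (u - l) / l ≤ l / u := by
        have : l / u - (1 - (u - l) / l) = (u - l) ^ 2 / (l * u) := by
          field_simp
          ring
        have : 0 ≤ (u - l) ^ 2 / (l * u) := by positivity
        linarith
      linarith [le_max_left ((u - l) / l) ((u - l) / (1 - u))]
    calc _ ≤ l / u / (l * (1 - l)) := by gcongr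
      _ = 1 / (u * (1 - l)) := by field_simp
      _ ≤ 1 / (x * (1 - x)) := by
        gcongr
        exacts [hx.2.le, hx.1.le]
  · refine klBern_le_of_inv_le hl hlu hu fun x hx => ?_
    have hx0 : 0 < x := hl.trans hx.1
    have hη : (1 - l) / (1 - u) ≤ 1 + max ((u - l) / l) ((u - l) / (1 - u)) := by
      have h : (1 - l) / (1 - u) = 1 + (u - l) / (1 - u) := by
        field_simp
        ring
      linarith [le_max_right ((u - l) / l) ((u - l) / (1 - u))]
    calc 1 / (x * (1 - x)) ≤ 1 / (l * (1 - u)) := by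
          gcongr
          exacts [hx.1.le, hx.2.le]
      _ = (1 - l) / (1 - u) / (l * (1 - l)) := by field_simp
      _ ≤ _ := by gcongr
end

section
/- Let Δ > 0 and let x be a real number with 0 < x and x + Δ < 1. Then the function t ↦ d(t, t+Δ) is differentiable at x with derivative equal to log(1 − Δ/((x+Δ)(1−x))) + Δ/((x+Δ)(1−x−Δ)). -/
/-- For `Δ > 0` and `0 < x` with `x + Δ < 1`, the map `t ↦ d(t, t+Δ)` is differentiable at `x`
with derivative `log(1 − Δ/((x+Δ)(1−x))) + Δ/((x+Δ)(1−x−Δ))`. -/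
theorem hasDerivAt_klBern_shift (Δ x : ℝ) (hΔ : 0 < Δ) (hx : 0 < x) (hxΔ : x + Δ < 1) :
    HasDerivAt (fun t => klBern t (t + Δ))
      (Real.log (1 - Δ / ((x + Δ) * (1 - x))) + Δ / ((x + Δ) * (1 - x - Δ))) x := by
  have hq : 0 < x + Δ := by linarith
  have hp' : 0 < 1 - x := by linarith
  have hq' : 0 < 1 - (x + Δ) := by linarith
  have hq'' : 1 - x - Δ ≠ 0 := by linarith
  have hshift : HasDerivAt (fun t : ℝ => t + Δ) 1 x := (hasDerivAt_id' x).add_const Δ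
  have hlog : HasDerivAt (fun t => Real.log (t / (t + Δ))) _ x :=
    ((hasDerivAt_id' x).fun_div hshift hq.ne').log (div_pos hx hq).ne'
  have hcompl : HasDerivAt (fun t : ℝ => 1 - t) (-1) x := (hasDerivAt_id' x).const_sub 1
  have hlog' : HasDerivAt (fun t => Real.log ((1 - t) / (1 - (t + Δ)))) _ x :=
    (hcompl.fun_div (hshift.const_sub 1) hq'.ne').log (div_pos hp' hq').ne'
  have hratio : 1 - Δ / ((x + Δ) * (1 - x)) = x / (x + Δ) / ((1 - x) / (1 - (x + Δ))) := by
    field_simp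
    ring
  unfold klBern
  refine (((hasDerivAt_id' x).fun_mul hlog).fun_add (hcompl.fun_mul hlog')).congr_deriv ?_
  rw [hratio, Real.log_div (div_pos hx hq).ne' (div_pos hp' hq').ne']
  field_simp
  ring
end

section
/- Let m, δ be real numbers with δ ≥ 0, 0 < m − δ, and m + δ < 1. Then d(m, m+δ) − d(m, m−δ) = ∫_0^δ 2x²(2m−1) / ((m² − x²)((1−m)² − x²)) dx. -/
theorem hasDerivAt_klBern_right {p q : ℝ} (hp0 : 0 < p) (hp1 : p < 1) (hq0 : 0 < q)
    (hq1 : q < 1) : HasDerivAt (klBern p) ((q - p) / (q * (1 - q))) q := by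
  have hp1' : 1 - p ≠ 0 := (sub_pos.2 hp1).ne'
  have hq1' : 1 - q ≠ 0 := (sub_pos.2 hq1).ne'
  have h₁ : HasDerivAt (fun y : ℝ => Real.log (p / y)) _ q :=
    ((hasDerivAt_const q p).div (hasDerivAt_id q) hq0.ne').log (div_ne_zero hp0.ne' hq0.ne')
  have h₂ : HasDerivAt (fun y : ℝ => Real.log ((1 - p) / (1 - y))) _ q :=
    ((hasDerivAt_const q (1 - p)).div ((hasDerivAt_id q).const_sub 1) hq1').log
      (div_ne_zero hp1' hq1')
  refine ((h₁.const_mul p).add (h₂.const_mul (1 - p))).congr_deriv ?_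
  have := hp0.ne'
  have := hq0.ne'
  simp only [id, Pi.div_apply]
  field_simp
  ring

/-- For `δ ≥ 0`, `0 < m − δ` and `m + δ < 1`,
`d(m, m+δ) − d(m, m−δ) = ∫_0^δ 2x²(2m−1)/((m²−x²)((1−m)²−x²)) dx`. -/
theorem klBern_symm_diff_eq_integral (m δ : ℝ) (hδ : 0 ≤ δ) (hm : 0 < m - δ)
    (hm' : m + δ < 1) :
    klBern m (m + δ) - klBern m (m - δ) =
      ∫ x in (0:ℝ)..δ, 2 * x ^ 2 * (2 * m - 1) / ((m ^ 2 - x ^ 2) * ((1 - m) ^ 2 - x ^ 2)) := by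
  have hne : ∀ x ∈ Set.uIcc 0 δ, (m ^ 2 - x ^ 2) * ((1 - m) ^ 2 - x ^ 2) ≠ 0 := by
    intro x hx
    rw [Set.uIcc_of_le hδ] at hx
    obtain ⟨hx0, hxδ⟩ := hx
    exact (mul_pos (by nlinarith) (by nlinarith)).ne'
  rw [intervalIntegral.integral_eq_sub_of_hasDerivAt
    (f := fun x => klBern m (m + x) - klBern m (m - x))]
  · simp
  · intro x hx
    rw [Set.uIcc_of_le hδ] at hx
    obtain ⟨hx0, hxδ⟩ := hx
    have h₁ := (hasDerivAt_klBern_right (p := m) (q := m + x) (by linarith) (by linarith)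
      (by linarith) (by linarith)).comp_const_add m x
    have h₂ := (hasDerivAt_klBern_right (p := m) (q := m - x) (by linarith) (by linarith)
      (by linarith) (by linarith)).comp_const_sub m x
    refine (h₁.sub h₂).congr_deriv ?_
    have e₁ : m + x ≠ 0 := by linarith
    have e₂ : m - x ≠ 0 := by linarith
    have e₃ : 1 - (m + x) ≠ 0 := by linarith
    have e₄ : 1 - (m - x) ≠ 0 := by linarith
    have hfac : (m ^ 2 - x ^ 2) * ((1 - m) ^ 2 - x ^ 2) =
        (m + x) * (m - x) * ((1 - (m + x)) * (1 - (m - x))) := by ring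
    rw [hfac]
    field_simp
    ring
  · refine ContinuousOn.intervalIntegrable (ContinuousOn.div ?_ ?_ hne) <;> fun_prop
end

section
/- There exists a universal constant C > 0 such that for all real numbers l, u with 0 < l ≤ u < 1 and u − l ≤ (1/2)·min(l, 1−u), writing m = (l+u)/2, one has |d(l,u) − (u−l)²/(2m(1−m))| ≤ C·(u−l)³/(l(1−l)·min(l, 1−u)) and |d(u,l) − (u−l)²/(2m(1−m))| ≤ C·(u−l)³/(l(1−l)·min(l, 1−u)). -/
theorem abs_log_one_add_sub_le {y : ℝ} (hy : 0 ≤ y) (hy' : y ≤ 1 / 2) :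
    |Real.log (1 + y) - 2 * y / (2 + y)| ≤ 9 / 4 * y ^ 3 := by
  have h := Real.abs_log_sub_add_sum_range_le (x := -y)
    (by rw [abs_neg, abs_of_nonneg hy]; linarith) 2
  rw [abs_neg, abs_of_nonneg hy, sub_neg_eq_add] at h
  simp only [Finset.sum_range_succ, Finset.sum_range_zero] at h
  norm_num at h
  have h1 : y ^ 3 / (1 - y) ≤ 2 * y ^ 3 := by
    rw [div_le_iff₀ (by linarith)]
    nlinarith [pow_nonneg hy 3]
  have h2 : 2 * y / (2 + y) = y - y ^ 2 / 2 + y ^ 3 / (2 * (2 + y)) := by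
    field_simp
    ring
  have h3 : y ^ 3 / (2 * (2 + y)) ≤ y ^ 3 / 4 := by
    gcongr
    linarith
  have h4 : 0 ≤ y ^ 3 / (2 * (2 + y)) := by positivity
  rw [h2]
  rw [abs_le] at h ⊢
  constructor <;> linarith [h.1, h.2]

/-- Second-order approximation of `log (a / b)`, with the error scaled by a weight
`w ≤ 3 b / 2`. -/
theorem mul_abs_log_div_sub_le {a b c w : ℝ} (hb : 0 < b) (hab : b ≤ a) (h : a - b ≤ b / 2)
    (hc : 0 < c) (hcb : c ≤ b) (hwb : w ≤ 3 / 2 * b) :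
    w * |Real.log (a / b) - 2 * (a - b) / (a + b)| ≤ 27 / 8 * ((a - b) ^ 3 / c ^ 2) := by
  have hd : 0 ≤ a - b := sub_nonneg.2 hab
  have key := abs_log_one_add_sub_le (y := (a - b) / b) (by positivity)
    (by rw [div_le_iff₀ hb]; linarith)
  have e1 : 1 + (a - b) / b = a / b := by
    field_simp
    ring
  have e2 : 2 * ((a - b) / b) / (2 + (a - b) / b) = 2 * (a - b) / (a + b) := by
    have : 2 + (a - b) / b = (a + b) / b := by
      field_simp
      ring
    rw [this]
    field_simp
  rw [e1, e2] at key
  calc w * |Real.log (a / b) - 2 * (a - b) / (a + b)|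
      ≤ (3 / 2 * b) * (9 / 4 * ((a - b) / b) ^ 3) := by gcongr
    _ = 27 / 8 * ((a - b) ^ 3 / b ^ 2) := by
      field_simp
      ring
    _ ≤ 27 / 8 * ((a - b) ^ 3 / c ^ 2) := by gcongr

theorem klBern_sub_eq {p q : ℝ} (hp : 0 < p) (hp' : p < 1) (hq : 0 < q) (hq' : q < 1) :
    klBern p q - (p - q) ^ 2 / (2 * ((p + q) / 2) * (1 - (p + q) / 2)) =
      p * (Real.log (p / q) - 2 * (p - q) / (p + q)) +
      (1 - p) * (Real.log ((1 - p) / (1 - q)) -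
        2 * ((1 - p) - (1 - q)) / ((1 - p) + (1 - q))) := by
  have h1 : p + q ≠ 0 := by linarith
  have h2 : (1 - p) + (1 - q) ≠ 0 := by linarith
  have h3 : 2 * ((p + q) / 2) * (1 - (p + q) / 2) = (p + q) * ((1 - p) + (1 - q)) / 2 := by ring
  rw [h3, klBern]
  field_simp
  ring

theorem abs_log_div_sub_comm (a b : ℝ) :
    |Real.log (a / b) - 2 * (a - b) / (a + b)| = |Real.log (b / a) - 2 * (b - a) / (b + a)| := by
  rw [← abs_neg, ← inv_div b a, Real.log_inv, add_comm a b]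
  congr 1
  ring

/-- There is a universal constant `C > 0` such that for `0 < l ≤ u < 1` with
`u − l ≤ (1/2)·min(l, 1−u)`, writing `m = (l+u)/2`, both `d(l,u)` and `d(u,l)` differ from
`(u−l)²/(2m(1−m))` by at most `C·(u−l)³/(l(1−l)·min(l, 1−u))`. -/
theorem klBern_midpoint_approx :
    ∃ C : ℝ, 0 < C ∧ ∀ l u : ℝ, 0 < l → l ≤ u → u < 1 →
      u - l ≤ (1 / 2) * min l (1 - u) →
      |klBern l u - (u - l) ^ 2 / (2 * ((l + u) / 2) * (1 - (l + u) / 2))| ≤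
        C * (u - l) ^ 3 / (l * (1 - l) * min l (1 - u)) ∧
      |klBern u l - (u - l) ^ 2 / (2 * ((l + u) / 2) * (1 - (l + u) / 2))| ≤
        C * (u - l) ^ 3 / (l * (1 - l) * min l (1 - u)) := by
  refine ⟨11, by norm_num, fun l u hl hlu hu h => ?_⟩
  set c := min l (1 - u) with hc_def
  have hc : 0 < c := lt_min hl (by linarith)
  have hcl : c ≤ l := min_le_left _ _
  have hcu : c ≤ 1 - u := min_le_right _ _
  have hd : 0 ≤ u - l := sub_nonneg.2 hlu
  have hprod : l * (1 - l) ≤ 3 / 2 * c := by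
    rcases min_choice l (1 - u) with hm | hm <;> rw [← hc_def] at hm <;> nlinarith
  have hbound : 27 / 4 * ((u - l) ^ 3 / c ^ 2) ≤ 11 * (u - l) ^ 3 / (l * (1 - l) * c) := by
    have hpos : 0 < l * (1 - l) := mul_pos hl (by linarith)
    calc 27 / 4 * ((u - l) ^ 3 / c ^ 2) ≤ 11 * (u - l) ^ 3 / (3 / 2 * c * c) := by
          rw [← mul_div_assoc, div_le_div_iff₀ (by positivity) (by positivity)]
          have : 0 ≤ (u - l) ^ 3 * c ^ 2 := by positivity
          nlinarith
      _ ≤ 11 * (u - l) ^ 3 / (l * (1 - l) * c) := by gcongr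
  have left : ∀ w, w ≤ 3 / 2 * l →
      w * |Real.log (u / l) - 2 * (u - l) / (u + l)| ≤ 27 / 8 * ((u - l) ^ 3 / c ^ 2) :=
    fun w => mul_abs_log_div_sub_le hl hlu (by linarith) hc hcl
  have right : ∀ w, w ≤ 3 / 2 * (1 - u) →
      w * |Real.log ((1 - l) / (1 - u)) - 2 * ((1 - l) - (1 - u)) / ((1 - l) + (1 - u))| ≤
        27 / 8 * ((u - l) ^ 3 / c ^ 2) := by
    intro w hw
    have := mul_abs_log_div_sub_le (a := 1 - l) (b := 1 - u) (by linarith) (by linarith)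
      (by linarith) hc hcu hw
    rwa [show (1 - l) - (1 - u) = u - l by ring] at this ⊢
  constructor
  · rw [← neg_sub l u, neg_sq, klBern_sub_eq hl (by linarith) (by linarith) hu, neg_sub]
    refine (abs_add_le _ _).trans (le_trans ?_ hbound)
    rw [abs_mul, abs_mul, abs_of_pos hl, abs_of_pos (by linarith : 0 < 1 - l),
      abs_log_div_sub_comm l u]
    linarith [left l (by linarith), right (1 - l) (by linarith)]
  · rw [add_comm l u, klBern_sub_eq (by linarith) hu hl (by linarith)]
    refine (abs_add_le _ _).trans (le_trans ?_ hbound)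
    rw [abs_mul, abs_mul, abs_of_pos (by linarith : 0 < u), abs_of_pos (by linarith : 0 < 1 - u),
      abs_log_div_sub_comm (1 - u) (1 - l)]
    linarith [left u (by linarith), right (1 - u) (by linarith)]
end

section
/- For every real number x ∈ (0,1), d(x, 1−x) ≥ log(1/(2.4·x)). -/
/-- The tangent-line bound `log a + 1 - a / y ≤ log y`. -/
lemma log_add_one_sub_div_le_log {a y : ℝ} (ha : 0 < a) (hy : 0 < y) :
    Real.log a + 1 - a / y ≤ Real.log y := by
  have h := Real.log_le_sub_one_of_pos (div_pos ha hy)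
  rw [Real.log_div ha.ne' hy.ne'] at h
  linarith

/-- The function `y ↦ y * log y` lies above its tangent lines. -/
lemma mul_log_add_sub_le_mul_log {a y : ℝ} (ha : 0 < a) (hy : 0 < y) :
    y * Real.log a + (y - a) ≤ y * Real.log y := by
  have h := mul_le_mul_of_nonneg_left (log_add_one_sub_div_le_log ha hy) hy.le
  have e : y * (Real.log a + 1 - a / y) = y * Real.log a + (y - a) := by
    field_simp
    ring
  rwa [e] at h

lemma klBern_self_compl {x : ℝ} (hx0 : 0 < x) (hx1 : x < 1) :
    klBern x (1 - x) = (1 - 2 * x) * (Real.log (1 - x) - Real.log x) := by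
  have hy : 0 < 1 - x := sub_pos.mpr hx1
  rw [klBern, sub_sub_cancel, Real.log_div hx0.ne' hy.ne', Real.log_div hy.ne' hx0.ne']
  ring

lemma eleven_div_le_log : (11 / 23 : ℝ) ≤ Real.log (12 / 5) + Real.log (23 / 34) := by
  rw [← Real.log_mul (by norm_num) (by norm_num), Real.le_log_iff_exp_le (by norm_num)]
  refine le_of_pow_le_pow_left₀ (n := 23) (by norm_num) (by norm_num) ?_
  calc Real.exp (11 / 23) ^ 23 = Real.exp 1 ^ 11 := by
        rw [← Real.exp_nat_mul, ← Real.exp_nat_mul]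
        norm_num
    _ ≤ 2.7182818286 ^ 11 := by
        gcongr
        exact Real.exp_one_lt_d9.le
    _ ≤ (12 / 5 * (23 / 34)) ^ 23 := by norm_num

lemma neg_one_le_log :
    -1 ≤ Real.log (12 / 5) + 2 * Real.log (11 / 34) - Real.log (23 / 34) := by
  have e : Real.log (12 / 5) + 2 * Real.log (11 / 34) - Real.log (23 / 34)
      = Real.log (12 / 5 * (11 / 34) ^ 2 / (23 / 34)) := by
    rw [Real.log_div (x := 12 / 5 * (11 / 34) ^ 2) (by norm_num) (by norm_num),
      Real.log_mul (by norm_num) (by norm_num), Real.log_pow, Nat.cast_ofNat]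
  rw [e, Real.le_log_iff_exp_le (by norm_num), Real.exp_neg]
  refine inv_le_of_inv_le₀ (by norm_num) (le_trans ?_ Real.exp_one_gt_d9.le)
  norm_num

/-- For every `x ∈ (0,1)`, `d(x, 1−x) ≥ log(1/(2.4·x))`. -/
theorem klBern_self_compl_ge (x : ℝ) (hx0 : 0 < x) (hx1 : x < 1) :
    klBern x (1 - x) ≥ Real.log (1 / (2.4 * x)) := by
  have hy : 0 < 1 - x := sub_pos.mpr hx1
  have e : (2.4 : ℝ) = 12 / 5 := by norm_num
  rw [klBern_self_compl hx0 hx1, e, one_div, Real.log_inv,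
    Real.log_mul (by norm_num) hx0.ne']
  -- The difference of the two sides is convex; bound it by its tangent line at `11 / 34`.
  have h₁ := mul_log_add_sub_le_mul_log (a := 11 / 34) (by norm_num) hx0
  have h₂ := mul_log_add_sub_le_mul_log (a := 23 / 34) (by norm_num) hy
  have h₃ := log_add_one_sub_div_le_log hy (by norm_num : (0 : ℝ) < 23 / 34)
  have h₄ := mul_le_mul_of_nonneg_left eleven_div_le_log hy.le
  have h₅ := mul_le_mul_of_nonneg_left neg_one_le_log hx0.le
  linarith
end

section
/- Let ε > 0, L ≥ 0, M ≥ 0, and let f, h : ℝ × ℝ → ℝ be measurable functions such that |f(x,y)| ≤ M for all (x,y) ∈ [0,1]² and |h(x,y) − h(y,x)| ≤ L for all (x,y) ∈ [0,1]² with |x − y| ≤ ε. Let D = {(x,y) ∈ [0,1]² : y < x < y + ε} and D' = {(x,y) ∈ [0,1]² : x < y < x + ε}, and assume (x,y) ↦ f(x,y)h(x,y) and (x,y) ↦ f(y,x)h(x,y) are integrable on [0,1]². Then |∫_D (x−y)·f(x,y)·h(x,y) dx dy − ∫_{D'} (y−x)·f(y,x)·h(x,y) dx dy| ≤ L·M·ε²/2.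 -/
open MeasureTheory

theorem measurableSet_narrow_band (ε : ℝ) :
    MeasurableSet {p : ℝ × ℝ | p.2 < p.1 ∧ p.1 < p.2 + ε} :=
  (measurableSet_lt measurable_snd measurable_fst).inter
    (measurableSet_lt measurable_fst (measurable_snd.add_const ε))

/-- The gap `x - y` integrated over the narrow band `y < x < y + ε` inside the unit square is at
most `ε² / 2`. -/
theorem integral_gap_band_le {ε : ℝ} (hε : 0 < ε) :
    ∫ p in {p : ℝ × ℝ | p ∈ Set.Icc (0 : ℝ) 1 ×ˢ Set.Icc (0 : ℝ) 1 ∧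
      p.2 < p.1 ∧ p.1 < p.2 + ε}, (p.1 - p.2) ≤ ε ^ 2 / 2 := by
  have hB : MeasurableSet {p : ℝ × ℝ | p.2 < p.1 ∧ p.1 < p.2 + ε} :=
    measurableSet_narrow_band ε
  have hi : IntegrableOn (fun p : ℝ × ℝ => p.1 - p.2)
      (Set.Icc (0 : ℝ) 1 ×ˢ Set.Icc (0 : ℝ) 1) :=
    ContinuousOn.integrableOn_compact (isCompact_Icc.prod isCompact_Icc)
      (by fun_prop)
  have hslice (y : ℝ) : ∫ x in Set.Ioo y (y + ε), (x - y) = ε ^ 2 / 2 := by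
    rw [← integral_Ioc_eq_integral_Ioo, ← intervalIntegral.integral_of_le (by linarith),
      intervalIntegral.integral_comp_sub_right (fun x => x)]
    simp
  have hD : {p : ℝ × ℝ | p ∈ Set.Icc (0 : ℝ) 1 ×ˢ Set.Icc (0 : ℝ) 1 ∧
      p.2 < p.1 ∧ p.1 < p.2 + ε} =
      (Set.Icc (0 : ℝ) 1 ×ˢ Set.Icc (0 : ℝ) 1) ∩ {p | p.2 < p.1 ∧ p.1 < p.2 + ε} := rfl
  have hi' := hi.indicator hB
  rw [IntegrableOn, Measure.volume_eq_prod, ← Measure.prod_restrict] at hi'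
  rw [hD, ← setIntegral_indicator hB, Measure.volume_eq_prod, ← Measure.prod_restrict,
    integral_prod_symm _ hi']
  calc
    _ ≤ ∫ _ in Set.Icc (0 : ℝ) 1, ε ^ 2 / 2 := by
      refine integral_mono hi'.integral_prod_right (integrable_const _) fun y => ?_
      have h_ind (x : ℝ) : {p : ℝ × ℝ | p.2 < p.1 ∧ p.1 < p.2 + ε}.indicator
          (fun p => p.1 - p.2) (x, y) = (Set.Ioo y (y + ε)).indicator (fun x => x - y) x := rfl
      simp only [h_ind]
      rw [setIntegral_indicator measurableSet_Ioo, ← hslice y]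
      refine setIntegral_mono_set ?_ ?_ Set.inter_subset_right.eventuallyLE
      · exact ((by fun_prop : Continuous fun x => x - y).integrableOn_Icc).mono_set
          Set.Ioo_subset_Icc_self
      · filter_upwards [ae_restrict_mem measurableSet_Ioo] with x hx
        exact sub_nonneg.2 hx.1.le
    _ = ε ^ 2 / 2 := by simp

/-- Quantitative exchangeable-mass lemma: if `|f| ≤ M` on `[0,1]²` and
`|h(x,y) − h(y,x)| ≤ L` on the band `|x−y| ≤ ε` of `[0,1]²`, then the gap-weighted masses of
the two narrow-win regions `D = {y < x < y + ε}` and `D' = {x < y < x + ε}` differ by at most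
`L·M·ε²/2`. -/
theorem exchangeable_mass (ε L M : ℝ) (hε : 0 < ε) (hL : 0 ≤ L) (hM : 0 ≤ M)
    (f h : ℝ × ℝ → ℝ) (hfm : Measurable f) (hhm : Measurable h)
    (hfb : ∀ p ∈ Set.Icc (0 : ℝ) 1 ×ˢ Set.Icc (0 : ℝ) 1, |f p| ≤ M)
    (hsym : ∀ p ∈ Set.Icc (0 : ℝ) 1 ×ˢ Set.Icc (0 : ℝ) 1, |p.1 - p.2| ≤ ε →
      |h p - h (p.2, p.1)| ≤ L)
    (hint : IntegrableOn (fun p => f p * h p) (Set.Icc (0 : ℝ) 1 ×ˢ Set.Icc (0 : ℝ) 1))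
    (hint' : IntegrableOn (fun p => f (p.2, p.1) * h p)
      (Set.Icc (0 : ℝ) 1 ×ˢ Set.Icc (0 : ℝ) 1)) :
    |(∫ p in {p : ℝ × ℝ | p ∈ Set.Icc (0 : ℝ) 1 ×ˢ Set.Icc (0 : ℝ) 1 ∧
          p.2 < p.1 ∧ p.1 < p.2 + ε}, (p.1 - p.2) * f p * h p) -
      ∫ p in {p : ℝ × ℝ | p ∈ Set.Icc (0 : ℝ) 1 ×ˢ Set.Icc (0 : ℝ) 1 ∧
          p.1 < p.2 ∧ p.2 < p.1 + ε}, (p.2 - p.1) * f (p.2, p.1) * h p| ≤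
    L * M * ε ^ 2 / 2 := by
  set Q : Set (ℝ × ℝ) := Set.Icc (0 : ℝ) 1 ×ˢ Set.Icc (0 : ℝ) 1 with hQ
  set D : Set (ℝ × ℝ) := {p | p ∈ Q ∧ p.2 < p.1 ∧ p.1 < p.2 + ε} with hD
  have hQm : MeasurableSet Q := measurableSet_Icc.prod measurableSet_Icc
  have hDm : MeasurableSet D := hQm.inter (measurableSet_narrow_band ε)
  have hDQ : D ⊆ Q := fun _ hp => hp.1
  have hswap : MeasurePreserving (Prod.swap : ℝ × ℝ → ℝ × ℝ) volume volume :=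
    Measure.measurePreserving_swap
  have hemb : MeasurableEmbedding (Prod.swap : ℝ × ℝ → ℝ × ℝ) :=
    MeasurableEquiv.prodComm.measurableEmbedding
  have hpreD : Prod.swap ⁻¹' {p : ℝ × ℝ | p ∈ Q ∧ p.1 < p.2 ∧ p.2 < p.1 + ε} = D := by
    ext p
    simp only [hQ, hD, Set.mem_preimage, Set.mem_ofPred_eq, Set.mem_prod, Prod.fst_swap,
      Prod.snd_swap]
    tauto
  have hpreQ : Prod.swap ⁻¹' Q = Q := by
    ext p
    simp only [hQ, Set.mem_preimage, Set.mem_prod, Prod.fst_swap, Prod.snd_swap]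
    tauto
  rw [← hswap.setIntegral_preimage_emb hemb _ {p | p ∈ Q ∧ p.1 < p.2 ∧ p.2 < p.1 + ε}, hpreD]
  simp only [Prod.fst_swap, Prod.snd_swap, Prod.mk.eta]
  have hint_swap : IntegrableOn (fun p => f p * h p.swap) Q := by
    have := (hswap.integrableOn_comp_preimage hemb).2 hint'
    rwa [hpreQ] at this
  have hgap : ∀ g : ℝ × ℝ → ℝ, IntegrableOn g Q →
      IntegrableOn (fun p => (p.1 - p.2) * g p) D := fun g hg =>
    (hg.continuousOn_mul (by fun_prop) (isCompact_Icc.prod isCompact_Icc)).mono_set hDQ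
  have h₁ : IntegrableOn (fun p => (p.1 - p.2) * f p * h p) D := by
    simpa only [mul_assoc] using hgap _ hint
  have h₂ : IntegrableOn (fun p => (p.1 - p.2) * f p * h p.swap) D := by
    simpa only [mul_assoc] using hgap _ hint_swap
  have h₃ : IntegrableOn (fun p : ℝ × ℝ => L * M * (p.1 - p.2)) D :=
    (ContinuousOn.integrableOn_compact (isCompact_Icc.prod isCompact_Icc)
      (by fun_prop)).mono_set hDQ
  rw [← integral_sub h₁ h₂, ← Real.norm_eq_abs]
  calc
    _ ≤ ∫ p in D, L * M * (p.1 - p.2) := by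
      refine norm_integral_le_of_norm_le h₃ ?_
      filter_upwards [ae_restrict_mem hDm] with p ⟨hpQ, hlt, hltε⟩
      have hgap_pos : 0 < p.1 - p.2 := sub_pos.2 hlt
      have hsymp : |h p - h p.swap| ≤ L :=
        hsym p hpQ (by rw [abs_of_pos hgap_pos]; linarith)
      rw [← mul_sub, Real.norm_eq_abs, abs_mul, abs_mul, abs_of_pos hgap_pos]
      calc
        _ ≤ (p.1 - p.2) * M * L := by gcongr; exact hfb p hpQ
        _ = L * M * (p.1 - p.2) := by ring
    _ = L * M * ∫ p in D, (p.1 - p.2) := integral_const_mul _ _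
    _ ≤ L * M * (ε ^ 2 / 2) := by gcongr; exact integral_gap_band_le hε
    _ = L * M * ε ^ 2 / 2 := by ring
end

section
/- For every natural number n ≥ 1, √(2π)·n^{n+1/2}·e^{−n}·e^{1/(12n+1)} < n! < √(2π)·n^{n+1/2}·e^{−n}·e^{1/(12n)}. -/
open scoped Real

open Filter Topology Stirling

/-- The decrements of `log (stirlingSeq n)` exceed those of `1 / (12 n + 1)`. -/
lemma lt_log_stirlingSeq_sdiff (m : ℕ) :
    1 / (12 * ((m : ℝ) + 1) + 1) - 1 / (12 * ((m : ℝ) + 2) + 1) <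
      Real.log (stirlingSeq (m + 1)) - Real.log (stirlingSeq (m + 2)) := by
  have h := le_hasSum (log_stirlingSeq_sdiff_hasSum m) 0 fun k _ => by positivity
  refine lt_of_lt_of_le ?_ h
  push_cast
  rw [div_sub_div _ _ (by positivity) (by positivity), pow_one, div_pow,
    div_mul_div_comm, div_lt_div_iff₀ (by positivity) (by positivity)]
  have hm : (0 : ℝ) ≤ m := m.cast_nonneg
  nlinarith

/-- The decrements of `log (stirlingSeq n)` are less than those of `1 / (12 n)`. -/
lemma log_stirlingSeq_sdiff_lt (m : ℕ) :
    Real.log (stirlingSeq (m + 1)) - Real.log (stirlingSeq (m + 2)) <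
      1 / (12 * ((m : ℝ) + 1)) - 1 / (12 * ((m : ℝ) + 2)) := by
  set x : ℝ := (1 / (2 * ↑(m + 1) + 1)) ^ 2 with hx
  have hx0 : 0 < x := by positivity
  have hx1 : x < 1 := by
    rw [hx, div_pow, div_lt_one (by positivity)]
    push_cast
    nlinarith [(m.cast_nonneg : (0 : ℝ) ≤ m)]
  have hgeom : HasSum (fun k : ℕ => 1 / 3 * x ^ (k + 1)) (1 / 3 * (x * (1 - x)⁻¹)) := by
    simpa only [pow_succ'] using
      ((hasSum_geometric_of_lt_one hx0.le hx1).mul_left x).mul_left (1 / 3)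
  have hsum : 1 / 3 * (x * (1 - x)⁻¹) = 1 / (12 * ((m : ℝ) + 1)) - 1 / (12 * ((m : ℝ) + 2)) := by
    have h1 : 1 - x = 4 * ((m : ℝ) + 1) * (m + 2) * x := by
      rw [hx]
      push_cast
      field_simp
      ring
    rw [h1]
    field_simp
    ring
  rw [← hsum]
  refine hasSum_lt (i := 1) (fun k => ?_) ?_ (log_stirlingSeq_sdiff_hasSum m) hgeom
  · refine mul_le_mul_of_nonneg_right ?_ (by positivity)
    refine one_div_le_one_div_of_le (by norm_num) ?_
    push_cast
    linarith [(k.cast_nonneg : (0 : ℝ) ≤ k)]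
  · exact mul_lt_mul_of_pos_right (by norm_num) (by positivity)

lemma tendsto_log_stirlingSeq_succ_sub {b : ℕ → ℝ} (hb : Tendsto b atTop (𝓝 0)) :
    Tendsto (fun m : ℕ => Real.log (stirlingSeq (m + 1)) - b m) atTop (𝓝 (Real.log √π)) := by
  have h := (tendsto_stirlingSeq_sqrt_pi.comp (tendsto_add_atTop_nat 1)).log
    (Real.sqrt_pos.2 Real.pi_pos).ne'
  simpa using h.sub hb

lemma log_sqrt_pi_add_lt_log_stirlingSeq (m : ℕ) :
    Real.log √π + 1 / (12 * ((m : ℝ) + 1) + 1) < Real.log (stirlingSeq (m + 1)) := by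
  have hanti : StrictAnti fun m : ℕ =>
      Real.log (stirlingSeq (m + 1)) - 1 / (12 * ((m : ℝ) + 1) + 1) := by
    refine strictAnti_nat_of_succ_lt fun k => ?_
    have := lt_log_stirlingSeq_sdiff k
    push_cast
    rw [add_assoc (k : ℝ), one_add_one_eq_two]
    linarith
  have hlim : Tendsto (fun m : ℕ => 1 / (12 * ((m : ℝ) + 1) + 1)) atTop (𝓝 0) := by
    simp only [one_div]
    exact tendsto_inv_atTop_zero.comp <| tendsto_atTop_add_const_right _ _ <|
      (tendsto_atTop_add_const_right _ _ tendsto_natCast_atTop_atTop).const_mul_atTop (by norm_num)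
  have hle := hanti.antitone.le_of_tendsto (tendsto_log_stirlingSeq_succ_sub hlim) (m + 1)
  have hlt := hanti m.lt_succ_self
  simp only [Nat.succ_eq_add_one] at hlt
  linarith

lemma log_stirlingSeq_lt_log_sqrt_pi_add (m : ℕ) :
    Real.log (stirlingSeq (m + 1)) < Real.log √π + 1 / (12 * ((m : ℝ) + 1)) := by
  have hmono : StrictMono fun m : ℕ =>
      Real.log (stirlingSeq (m + 1)) - 1 / (12 * ((m : ℝ) + 1)) := by
    refine strictMono_nat_of_lt_succ fun k => ?_
    have := log_stirlingSeq_sdiff_lt k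
    push_cast
    rw [add_assoc (k : ℝ), one_add_one_eq_two]
    linarith
  have hlim : Tendsto (fun m : ℕ => 1 / (12 * ((m : ℝ) + 1))) atTop (𝓝 0) := by
    simp only [one_div]
    exact tendsto_inv_atTop_zero.comp <|
      (tendsto_atTop_add_const_right _ _ tendsto_natCast_atTop_atTop).const_mul_atTop (by norm_num)
  have hle := hmono.monotone.ge_of_tendsto (tendsto_log_stirlingSeq_succ_sub hlim) (m + 1)
  have hlt := hmono m.lt_succ_self
  simp only [Nat.succ_eq_add_one] at hlt
  linarith

/-- Robbins' refined form of Stirling's approximation: for `n ≥ 1`,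
`√(2π)·n^{n+1/2}·e^{−n}·e^{1/(12n+1)} < n! < √(2π)·n^{n+1/2}·e^{−n}·e^{1/(12n)}`. -/
theorem robbins_stirling (n : ℕ) (hn : 1 ≤ n) :
    Real.sqrt (2 * π) * (n : ℝ) ^ ((n : ℝ) + 1 / 2) * Real.exp (-(n : ℝ)) *
        Real.exp (1 / (12 * (n : ℝ) + 1)) < (n.factorial : ℝ) ∧
    (n.factorial : ℝ) < Real.sqrt (2 * π) * (n : ℝ) ^ ((n : ℝ) + 1 / 2) *
        Real.exp (-(n : ℝ)) * Real.exp (1 / (12 * (n : ℝ))) := by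
  obtain ⟨m, rfl⟩ := Nat.exists_eq_add_of_le' hn
  have hs := stirlingSeq'_pos m
  have hpi : 0 < √π := Real.sqrt_pos.2 Real.pi_pos
  have hlow := log_sqrt_pi_add_lt_log_stirlingSeq m
  have hupp := log_stirlingSeq_lt_log_sqrt_pi_add m
  rw [Real.lt_log_iff_exp_lt hs, Real.exp_add, Real.exp_log hpi] at hlow
  rw [Real.log_lt_iff_lt_exp hs, Real.exp_add, Real.exp_log hpi] at hupp
  rw [← Nat.cast_add_one] at hlow hupp
  set n := m + 1
  have hn0 : (0 : ℝ) < n := by exact_mod_cast hn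
  set c : ℝ := √(2 * n) * (n / Real.exp 1) ^ n with hc
  have hc0 : 0 < c := by positivity
  have hfact : (n.factorial : ℝ) = stirlingSeq n * c := by
    rw [stirlingSeq, div_mul_cancel₀ _ hc0.ne']
  have hmain : Real.sqrt (2 * π) * (n : ℝ) ^ ((n : ℝ) + 1 / 2) * Real.exp (-(n : ℝ)) = √π * c := by
    rw [hc, Real.rpow_add hn0, Real.rpow_natCast, ← Real.sqrt_eq_rpow, Real.exp_neg, div_pow,
      ← Real.exp_nat_mul, mul_one, Real.sqrt_mul zero_le_two, Real.sqrt_mul zero_le_two]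
    ring
  rw [hmain, hfact, mul_right_comm _ c, mul_right_comm _ c]
  exact ⟨mul_lt_mul_of_pos_right hlow hc0, mul_lt_mul_of_pos_right hupp hc0⟩
end

section
/- For all natural numbers n, k with 0 < k < n and every m ∈ (0,1), writing p̂ = k/n, the binomial probability satisfies e^{−1/(12k) − 1/(12(n−k))} · √(n/(2π·k·(n−k))) · e^{−n·d(p̂, m)} ≤ C(n,k)·m^k·(1−m)^{n−k} ≤ e^{1/(12n)} · √(n/(2π·k·(n−k))) · e^{−n·d(p̂, m)}, where C(n,k) = n!/(k!(n−k)!) is the binomial coefficient. -/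
open scoped Real

open Filter Topology in
/-- Robbins' upper bound for the factorial, in logarithmic form. -/
theorem log_factorial_le_stirling {n : ℕ} (hn : n ≠ 0) :
    Real.log (n.factorial : ℝ) ≤
      n * Real.log n - n + Real.log n / 2 + Real.log (2 * π) / 2 + 1 / (12 * (n : ℝ)) := by
  obtain ⟨n, rfl⟩ := Nat.exists_eq_succ_of_ne_zero hn
  have hmono : Monotone fun j : ℕ =>
      Real.log (Stirling.stirlingSeq (j + 1)) - 1 / (12 * ((j + 1 : ℕ) : ℝ)) := by
    refine monotone_nat_of_le_succ fun j => ?_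
    have h := Stirling.log_stirlingSeq_sdiff_le (j + 1)
    have e : 1 / (12 * ((j + 1 : ℕ) : ℝ) * (((j + 1 : ℕ) : ℝ) + 1)) =
        1 / (12 * ((j + 1 : ℕ) : ℝ)) - 1 / (12 * ((j + 1 + 1 : ℕ) : ℝ)) := by
      push_cast
      field_simp
      ring
    linarith
  have hinv : Tendsto (fun j : ℕ => 1 / (12 * ((j + 1 : ℕ) : ℝ))) atTop (𝓝 0) := by
    have h := (tendsto_one_div_add_atTop_nhds_zero_nat (𝕜 := ℝ)).const_mul (1 / 12)
    rw [mul_zero] at h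
    refine h.congr fun j => ?_
    push_cast
    field_simp
  have hlim : Tendsto (fun j : ℕ =>
      Real.log (Stirling.stirlingSeq (j + 1)) - 1 / (12 * ((j + 1 : ℕ) : ℝ))) atTop
      (𝓝 (Real.log √π - 0)) :=
    ((Stirling.tendsto_stirlingSeq_sqrt_pi.comp (tendsto_add_atTop_nat 1)).log
      (by positivity)).sub hinv
  have hle := hmono.ge_of_tendsto hlim n
  have hpos : (0 : ℝ) < (n + 1 : ℕ) := by positivity
  rw [Stirling.log_stirlingSeq_formula, Real.log_sqrt Real.pi_pos.le,
    Real.log_mul two_ne_zero hpos.ne', Real.log_div hpos.ne' (Real.exp_ne_zero 1),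
    Real.log_exp] at hle
  rw [Nat.succ_eq_add_one, Real.log_mul two_ne_zero Real.pi_ne_zero]
  linarith

/-- Local estimate of the binomial probability mass function via Robbins' form of Stirling's
approximation: for `0 < k < n` and `m ∈ (0,1)`, with `p̂ = k/n`,
`e^{−1/(12k) − 1/(12(n−k))}·√(n/(2π·k·(n−k)))·e^{−n·d(p̂,m)} ≤ C(n,k)·m^k·(1−m)^{n−k}
  ≤ e^{1/(12n)}·√(n/(2π·k·(n−k)))·e^{−n·d(p̂,m)}`. -/
theorem binomial_pmf_local_estimate (n k : ℕ) (hk0 : 0 < k) (hkn : k < n)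
    (m : ℝ) (hm0 : 0 < m) (hm1 : m < 1) :
    Real.exp (-(1 / (12 * (k : ℝ))) - 1 / (12 * ((n : ℝ) - (k : ℝ)))) *
        Real.sqrt ((n : ℝ) / (2 * π * (k : ℝ) * ((n : ℝ) - (k : ℝ)))) *
        Real.exp (-(n : ℝ) * klBern ((k : ℝ) / (n : ℝ)) m) ≤
      (n.choose k : ℝ) * m ^ k * (1 - m) ^ (n - k) ∧
    (n.choose k : ℝ) * m ^ k * (1 - m) ^ (n - k) ≤
      Real.exp (1 / (12 * (n : ℝ))) *
        Real.sqrt ((n : ℝ) / (2 * π * (k : ℝ) * ((n : ℝ) - (k : ℝ)))) *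
        Real.exp (-(n : ℝ) * klBern ((k : ℝ) / (n : ℝ)) m) := by
  obtain ⟨j, rfl⟩ := Nat.exists_eq_add_of_le hkn.le
  have hj0 : 0 < j := by omega
  have hk : (0 : ℝ) < k := Nat.cast_pos.mpr hk0
  have hj : (0 : ℝ) < j := Nat.cast_pos.mpr hj0
  have hn : (0 : ℝ) < ((k + j : ℕ) : ℝ) := Nat.cast_pos.mpr (by omega)
  have hm : 0 < 1 - m := sub_pos.mpr hm1
  have hsub : ((k + j : ℕ) : ℝ) - k = j := by push_cast; ring
  have hpmf : ((k + j).choose k : ℝ) * m ^ k * (1 - m) ^ (k + j - k) =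
      Real.exp (Real.log ((k + j).factorial : ℝ) - Real.log (k.factorial : ℝ)
        - Real.log (j.factorial : ℝ) + k * Real.log m + j * Real.log (1 - m)) := by
    rw [Nat.add_sub_cancel_left, Nat.cast_add_choose, Real.exp_add, Real.exp_add, Real.exp_sub,
      Real.exp_sub, Real.exp_log (by positivity), Real.exp_log (by positivity),
      Real.exp_log (by positivity), ← Real.log_pow, ← Real.log_pow,
      Real.exp_log (by positivity), Real.exp_log (by positivity), div_div]
  have hsqrt : √(((k + j : ℕ) : ℝ) / (2 * π * k * j)) =
      Real.exp ((Real.log ((k + j : ℕ) : ℝ) - Real.log (2 * π) - Real.log k - Real.log j) / 2) := by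
    rw [← Real.exp_log (show 0 < √(((k + j : ℕ) : ℝ) / (2 * π * k * j)) by positivity),
      Real.log_sqrt (by positivity), Real.log_div (by positivity) (by positivity),
      Real.log_mul (by positivity) (by positivity), Real.log_mul (by positivity) (by positivity)]
    congr 1
    ring
  have hkl : -((k + j : ℕ) : ℝ) * klBern ((k : ℝ) / ((k + j : ℕ) : ℝ)) m =
      -(k * (Real.log k - Real.log ((k + j : ℕ) : ℝ) - Real.log m)
        + j * (Real.log j - Real.log ((k + j : ℕ) : ℝ) - Real.log (1 - m))) := by
    have hcompl : 1 - (k : ℝ) / ((k + j : ℕ) : ℝ) = j / ((k + j : ℕ) : ℝ) := by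
      rw [one_sub_div hn.ne', hsub]
    rw [klBern, hcompl, Real.log_div (by positivity) hm0.ne', Real.log_div hk.ne' hn.ne',
      Real.log_div (by positivity) hm.ne', Real.log_div hj.ne' hn.ne']
    field_simp
  have hln := Stirling.le_log_factorial_stirling (n := k + j) (by omega)
  have hlk := Stirling.le_log_factorial_stirling hk0.ne'
  have hlj := Stirling.le_log_factorial_stirling hj0.ne'
  have hun := log_factorial_le_stirling (n := k + j) (by omega)
  have huk := log_factorial_le_stirling hk0.ne'
  have huj := log_factorial_le_stirling hj0.ne'
  have hlog : ((k + j : ℕ) : ℝ) * Real.log ((k + j : ℕ) : ℝ) =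
      k * Real.log ((k + j : ℕ) : ℝ) + j * Real.log ((k + j : ℕ) : ℝ) := by
    rw [← add_mul, Nat.cast_add]
  rw [hsub, hpmf, hsqrt, hkl, ← Real.exp_add, ← Real.exp_add, ← Real.exp_add, ← Real.exp_add,
    Real.exp_le_exp, Real.exp_le_exp]
  constructor <;> linarith
end
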